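/- Let R^7 be the profile ≽_1: a,{b,c,d}; ≽_2: b,{a,c,d}; ≽_3: a,{b,c,d}; ≽_4: b,{a,c,d}. Then f(R^7)(c) = f(R^7)(d) = 0 and f(R^7)(a) = f(R^7)(b) = 1/2. -/

import Mathlib

open Finset
open scoped Classical

section Framework

variable {A : Type*} [Fintype A] {n : ℕ}

/-- `p` is a lottery (probability distribution) on the set of alternatives `A`. -/
def IsLottery (p : A → ℝ) : Prop := (∀ x, 0 ≤ p x) ∧ ∑ x, p x = 1

/-- `r` is a weak preference relation: complete (total) and transitive. -/
def IsPref (r : A → A → Prop) : Prop := Total r ∧ Transitive r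

/-- A preference profile assigns a weak preference relation to each of the `n` agents. -/
def IsProfile (R : Fin n → A → A → Prop) : Prop := ∀ i, IsPref (R i)

/-- The probability that `p` assigns to alternatives weakly preferred (by `r`) to `x`. -/
noncomputable def upperProb (r : A → A → Prop) (p : A → ℝ) (x : A) : ℝ :=
  ∑ y ∈ univ.filter (fun y => r y x), p y

/-- Stochastic dominance: `p ≽^sd q` w.r.t. the preference relation `r`. -/
def SDge (r : A → A → Prop) (p q : A → ℝ) : Prop :=
  ∀ x, upperProb r q x ≤ upperProb r p x

/-- Strict stochastic dominance: `p ≻^sd q` w.r.t. the preference relation `r`. -/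
def SDgt (r : A → A → Prop) (p q : A → ℝ) : Prop :=
  SDge r p q ∧ ¬ SDge r q p

/-- A social decision scheme maps every preference profile to a lottery. -/
def IsSDS (f : (Fin n → A → A → Prop) → (A → ℝ)) : Prop :=
  ∀ R : Fin n → A → A → Prop, IsProfile R → IsLottery (f R)

/-- Anonymity: invariance under permutations of the agents. -/
def Anonymous (f : (Fin n → A → A → Prop) → (A → ℝ)) : Prop :=
  ∀ R : Fin n → A → A → Prop, IsProfile R → ∀ π : Equiv.Perm (Fin n),
    f (fun i => R (π i)) = f R

/-- Neutrality: `f(R^σ)(σ x) = f(R)(x)`, where `R^σ` relabels alternatives by `σ`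
(i.e. `σ x ≽^σ_i σ y ↔ x ≽_i y`). -/
def Neutral (f : (Fin n → A → A → Prop) → (A → ℝ)) : Prop :=
  ∀ R : Fin n → A → A → Prop, IsProfile R → ∀ σ : Equiv.Perm A, ∀ x : A,
    f (fun i u v => R i (σ.symm u) (σ.symm v)) (σ x) = f R x

/-- The lottery `p` is sd-efficient for the profile `R`: no lottery `q` is weakly
sd-preferred to `p` by all agents and strictly sd-preferred by some agent. -/
def SDEfficientLottery (R : Fin n → A → A → Prop) (p : A → ℝ) : Prop :=
  ¬ ∃ q : A → ℝ, IsLottery q ∧ (∀ i, SDge (R i) q p) ∧ (∃ i, SDgt (R i) q p)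

/-- sd-efficiency of a social decision scheme. -/
def SDEfficient (f : (Fin n → A → A → Prop) → (A → ℝ)) : Prop :=
  ∀ R : Fin n → A → A → Prop, IsProfile R → SDEfficientLottery R (f R)

/-- sd-strategyproofness: no agent can misreport and obtain a strictly
sd-preferred lottery. -/
def SDStrategyproof (f : (Fin n → A → A → Prop) → (A → ℝ)) : Prop :=
  ∀ R R' : Fin n → A → A → Prop, IsProfile R → IsProfile R' → ∀ i : Fin n,
    (∀ j, j ≠ i → R j = R' j) → ¬ SDgt (R i) (f R') (f R)

/-- `x` is the unique most-preferred alternative of the relation `r`. -/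
def UniqueTop (r : A → A → Prop) (x : A) : Prop :=
  ∀ y, y ≠ x → r x y ∧ ¬ r y x

/-- `f` extends random dictatorship: whenever every agent has a unique top choice,
each alternative gets probability (number of agents having it as top)/n. -/
def ExtendsRD (f : (Fin n → A → A → Prop) → (A → ℝ)) : Prop :=
  ∀ R : Fin n → A → A → Prop, IsProfile R →
    ∀ t : Fin n → A, (∀ i, UniqueTop (R i) (t i)) →
      ∀ x : A, f R x = ((univ.filter (fun i => t i = x)).card : ℝ) / (n : ℝ)

/-- `x` is Pareto-dominated in the profile `R`. -/
def Pareto_Dominated (R : Fin n → A → A → Prop) (x : A) : Prop :=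
  ∃ y : A, (∀ i, R i y x) ∧ ∃ i, R i y x ∧ ¬ R i x y

end Framework

/-! Concrete setting: alternatives `A = {a,b,c,d}` encoded as `Fin 4`. -/

/-- The alternative `a`. -/ def a : Fin 4 := 0
/-- The alternative `b`. -/ def b : Fin 4 := 1
/-- The alternative `c`. -/ def c : Fin 4 := 2
/-- The alternative `d`. -/ def d : Fin 4 := 3

/-- The weak preference relation induced by a rank function over `(a,b,c,d)`
(lower rank = more preferred; equal ranks = indifference). -/
def pr (rk : Fin 4 → ℕ) : Fin 4 → Fin 4 → Prop := fun x y => rk x ≤ rk y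


/-- The profile `R7`: ≽₁: a,{b,c,d}; ≽₂: b,{a,c,d}; ≽₃: a,{b,c,d}; ≽₄: b,{a,c,d}. -/
def R7 : Fin 4 → Fin 4 → Fin 4 → Prop :=
  ![pr ![0,1,1,1], pr ![1,0,1,1], pr ![0,1,1,1], pr ![1,0,1,1]]

theorem isPref_pr (rk : Fin 4 → ℕ) : IsPref (pr rk) :=
  ⟨fun x y => le_total (rk x) (rk y), fun _ _ _ h₁ h₂ => le_trans h₁ h₂⟩

theorem isProfile_R7 : IsProfile R7 := by
  intro i
  fin_cases i <;> exact isPref_pr _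

theorem upperProb_pr (rk : Fin 4 → ℕ) (p : Fin 4 → ℝ) (x : Fin 4) :
    upperProb (pr rk) p x =
      (if rk 0 ≤ rk x then p 0 else 0) + (if rk 1 ≤ rk x then p 1 else 0) +
        (if rk 2 ≤ rk x then p 2 else 0) + (if rk 3 ≤ rk x then p 3 else 0) := by
  rw [upperProb, sum_filter, Fin.sum_univ_four]
  congr!

/-- Agents who single out `a` compare lotteries by the probability of `a`. -/
theorem sdge_top_a_iff {p q : Fin 4 → ℝ} (hp : IsLottery p) (hq : IsLottery q) :
    SDge (pr ![0, 1, 1, 1]) q p ↔ p 0 ≤ q 0 := by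
  have hp' := hp.2
  have hq' := hq.2
  rw [Fin.sum_univ_four] at hp' hq'
  simp [SDge, Fin.forall_fin_succ, upperProb_pr, hp', hq']

/-- Agents who single out `b` compare lotteries by the probability of `b`. -/
theorem sdge_top_b_iff {p q : Fin 4 → ℝ} (hp : IsLottery p) (hq : IsLottery q) :
    SDge (pr ![1, 0, 1, 1]) q p ↔ p 1 ≤ q 1 := by
  have hp' := hp.2
  have hq' := hq.2
  rw [Fin.sum_univ_four] at hp' hq'
  simp [SDge, Fin.forall_fin_succ, upperProb_pr, hp', hq']

/-- An sd-efficient lottery for `R7` puts no probability on the dominated alternatives `c`, `d`. -/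
theorem SDEfficientLottery.add_nonpos_of_R7 {p : Fin 4 → ℝ} (hp : IsLottery p)
    (heff : SDEfficientLottery R7 p) : p 2 + p 3 ≤ 0 := by
  by_contra! hpos
  have hsum := hp.2
  rw [Fin.sum_univ_four] at hsum
  have hq : IsLottery ![p 0 + (p 2 + p 3), p 1, 0, 0] := by
    refine ⟨?_, ?_⟩
    · simp only [Fin.forall_fin_succ]
      simpa [hp.1] using add_nonneg (hp.1 0) hpos.le
    · simp [Fin.sum_univ_four]
      linarith
  have hA : SDge (pr ![0, 1, 1, 1]) ![p 0 + (p 2 + p 3), p 1, 0, 0] p :=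
    (sdge_top_a_iff hp hq).2 (by simpa using hpos.le)
  have hB : SDge (pr ![1, 0, 1, 1]) ![p 0 + (p 2 + p 3), p 1, 0, 0] p :=
    (sdge_top_b_iff hp hq).2 (by simp)
  refine heff ⟨_, hq, ?_, 0, hA, ?_⟩
  · intro i
    fin_cases i
    exacts [hA, hB, hA, hB]
  · change ¬ SDge (pr ![0, 1, 1, 1]) p _
    rw [sdge_top_a_iff hq hp]
    simpa using hpos

/-- Exchanging `a` and `b` in `R7` amounts to permuting the agents. -/
theorem R7_swap :
    (fun i u v => R7 i ((Equiv.swap (0 : Fin 4) 1).symm u) ((Equiv.swap (0 : Fin 4) 1).symm v)) =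
      fun i => R7 ((Equiv.swap 0 1 * Equiv.swap 2 3 : Equiv.Perm (Fin 4)) i) := by
  funext i u v
  fin_cases i <;> fin_cases u <;> fin_cases v <;> simp [R7, pr, Equiv.swap_apply_def]

theorem stmt10 (f : (Fin 4 → Fin 4 → Fin 4 → Prop) → (Fin 4 → ℝ))
    (hf : IsSDS f) (han : Anonymous f) (hneu : Neutral f)
    (heff : SDEfficient f) (hsp : SDStrategyproof f) :
    f R7 c = 0 ∧ f R7 d = 0 ∧ f R7 a = 1/2 ∧ f R7 b = 1/2 := by
  have hp := hf R7 isProfile_R7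
  have hcd := (heff R7 isProfile_R7).add_nonpos_of_R7 hp
  have hab : f R7 1 = f R7 0 := by
    have h := hneu R7 isProfile_R7 (Equiv.swap 0 1) 0
    rwa [R7_swap, han R7 isProfile_R7, Equiv.swap_apply_left] at h
  have hsum := hp.2
  rw [Fin.sum_univ_four] at hsum
  have h2 := hp.1 2
  have h3 := hp.1 3
  unfold a b c d
  refine ⟨?_, ?_, ?_, ?_⟩ <;> linarith
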